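/- Commutant of the sublattice magnetizations on the temporal lattice: fix t ≥ 1 and consider the Hilbert space (ℂ²)^{⊗2t} of 2t qubits at sites labelled by ℤ/(2t). Let Π be the unitary cyclically shifting the sites by one, and for a, b ∈ {x, y, z} and ι ∈ {0,1} define the sublattice magnetizations M_{a,ι} = Σ_{τ=0}^{t−1} σ^a_{2τ+ι} and the double magnetizations M_{ab,ι} = Σ_{τ=0}^{t−1} σ^a_{2τ+ι} σ^b_{2τ+ι+1}, indices taken mod 2t, where σ^a_j denotes the Pauli matrix σ^a acting on site j. Then a 2^{2t} × 2^{2t} complex matrix A commutes with all twelve operators M_{a,ι} and all M_{ab,ι} (a, b ∈ {x,y,z}, ι ∈ {0,1}) if and only if A is a linear combination of the even shift powers Π^{2n}, n = 0, 1, …, t−1; in particular this commutant has dimension t. -/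

import Mathlib

/- Commutant of the sublattice magnetizations on the temporal lattice of `2t` qubits. -/

/-- The Pauli matrices `σ^x, σ^y, σ^z`. -/
def pauli : Fin 3 → Matrix (Fin 2) (Fin 2) ℂ
  | 0 => !![0, 1; 1, 0]
  | 1 => !![0, -Complex.I; Complex.I, 0]
  | 2 => !![1, 0; 0, -1]

/-- Configurations of `n` qubits. -/
abbrev Cfg (n : ℕ) := Fin n → Fin 2

/-- The site `x mod n` of a lattice of `n` sites. -/
def site (n : ℕ) (hn : 0 < n) (x : ℕ) : Fin n := ⟨x % n, Nat.mod_lt x hn⟩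

/-- The Pauli matrix `σ^a` acting on site `j` of the chain. -/
def pauliAt (n : ℕ) (a : Fin 3) (j : Fin n) : Matrix (Cfg n) (Cfg n) ℂ :=
  fun f g => pauli a (f j) (g j) * (if ∀ i, i ≠ j → f i = g i then 1 else 0)

/-- The sublattice magnetization `M_{a,ι} = Σ_{τ=0}^{t−1} σ^a_{2τ+ι}`. -/
noncomputable def M1 (t : ℕ) (ht : 0 < t) (a : Fin 3) (ι : Fin 2) : Matrix (Cfg (2 * t)) (Cfg (2 * t)) ℂ :=
  ∑ τ : Fin t, pauliAt (2 * t) a (site (2 * t) (by omega) (2 * τ.val + ι.val))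

/-- The sublattice double magnetization
`M_{ab,ι} = Σ_{τ=0}^{t−1} σ^a_{2τ+ι} σ^b_{2τ+ι+1}`. -/
noncomputable def M2 (t : ℕ) (ht : 0 < t) (a b : Fin 3) (ι : Fin 2) :
    Matrix (Cfg (2 * t)) (Cfg (2 * t)) ℂ :=
  ∑ τ : Fin t,
    pauliAt (2 * t) a (site (2 * t) (by omega) (2 * τ.val + ι.val)) *
      pauliAt (2 * t) b (site (2 * t) (by omega) (2 * τ.val + ι.val + 1))

/-- The cyclic one-site shift `Π`. -/
def shiftOp (t : ℕ) (ht : 0 < t) : Matrix (Cfg (2 * t)) (Cfg (2 * t)) ℂ :=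
  fun f g => if ∀ j : Fin (2 * t), f (site (2 * t) (by omega) (j.val + 1)) = g j then 1 else 0

/-- The identity and the Pauli matrices span the `2 × 2` matrices. -/
theorem pauli_induction {p : Matrix (Fin 2) (Fin 2) ℂ → Prop} (one : p 1)
    (pauli : ∀ a, p (pauli a)) (add : ∀ X Y, p X → p Y → p (X + Y))
    (smul : ∀ (c : ℂ) X, p X → p (c • X)) (X : Matrix (Fin 2) (Fin 2) ℂ) : p X := by
  have hX : X = ((X 0 0 + X 1 1) / 2) • (1 : Matrix (Fin 2) (Fin 2) ℂ)
      + ((X 0 1 + X 1 0) / 2) • _root_.pauli 0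
      + (Complex.I * (X 0 1 - X 1 0) / 2) • _root_.pauli 1
      + ((X 0 0 - X 1 1) / 2) • _root_.pauli 2 := by
    ext i j
    fin_cases i <;> fin_cases j <;> simp [_root_.pauli] <;> ring_nf <;>
      simp only [Complex.I_sq] <;> ring
  rw [hX]
  exact add _ _ (add _ _ (add _ _ (smul _ _ one) (smul _ _ (pauli 0))) (smul _ _ (pauli 1)))
    (smul _ _ (pauli 2))

/-- The matrix `X` acting on site `j`. -/
def siteOp (n : ℕ) (X : Matrix (Fin 2) (Fin 2) ℂ) (j : Fin n) : Matrix (Cfg n) (Cfg n) ℂ :=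
  fun f g => X (f j) (g j) * (if ∀ i, i ≠ j → f i = g i then 1 else 0)

theorem siteOp_pauli (n : ℕ) (a : Fin 3) (j : Fin n) : siteOp n (pauli a) j = pauliAt n a j := rfl

theorem siteOp_add (n : ℕ) (X Y : Matrix (Fin 2) (Fin 2) ℂ) (j : Fin n) :
    siteOp n (X + Y) j = siteOp n X j + siteOp n Y j := by
  ext f g
  simp only [siteOp, Matrix.add_apply, add_mul]

theorem siteOp_smul (n : ℕ) (c : ℂ) (X : Matrix (Fin 2) (Fin 2) ℂ) (j : Fin n) :
    siteOp n (c • X) j = c • siteOp n X j := by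
  ext f g
  simp only [siteOp, Matrix.smul_apply, smul_eq_mul, mul_assoc]

theorem siteOp_one (n : ℕ) (j : Fin n) : siteOp n 1 j = 1 := by
  ext f g
  by_cases h : f = g
  · subst h; simp [siteOp]
  · rw [Matrix.one_apply_ne h]
    simp only [siteOp, Matrix.one_apply, mul_ite, mul_one, mul_zero]
    split_ifs with h1 h2
    · refine absurd (funext fun i => ?_) h
      by_cases hi : i = j
      · rw [hi, h2]
      · exact h1 i hi
    · rfl
    · rfl

theorem siteOp_single_apply (n : ℕ) (a b : Fin 2) (j : Fin n) (f g : Cfg n) :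
    siteOp n (Matrix.single a b 1) j f g =
      if f = Function.update g j a then (if g j = b then 1 else 0) else 0 := by
  have key : f = Function.update g j a ↔ a = f j ∧ ∀ i, i ≠ j → f i = g i := by
    rw [Function.eq_update_iff, eq_comm]
  simp only [siteOp, Matrix.single_apply, key, eq_comm (a := g j)]
  by_cases h1 : a = f j <;> by_cases h2 : b = g j <;>
    by_cases h3 : ∀ i, i ≠ j → f i = g i <;> simp [h1, h2, h3]

theorem mul_siteOp_single_apply (n : ℕ) (A : Matrix (Cfg n) (Cfg n) ℂ) (a b : Fin 2) (j : Fin n)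
    (f g : Cfg n) :
    (A * siteOp n (Matrix.single a b 1) j) f g =
      if g j = b then A f (Function.update g j a) else 0 := by
  simp [Matrix.mul_apply, siteOp_single_apply]

theorem siteOp_single_self (n : ℕ) (a : Fin 2) (j : Fin n) :
    siteOp n (Matrix.single a a 1) j = Matrix.diagonal fun f => if f j = a then 1 else 0 := by
  ext f g
  rw [siteOp_single_apply, Matrix.diagonal_apply]
  by_cases h : g j = a
  · subst h
    rw [Function.update_eq_self]
    split_ifs with h1 h2 <;> simp_all
  · split_ifs <;> simp_all

/-- The operator permuting the sites. -/
def permOp {n : ℕ} (σ : Equiv.Perm (Fin n)) : Matrix (Cfg n) (Cfg n) ℂ :=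
  fun f g => if f ∘ σ = g then 1 else 0

theorem permOp_mul_apply {n : ℕ} (σ : Equiv.Perm (Fin n)) (B : Matrix (Cfg n) (Cfg n) ℂ)
    (f g : Cfg n) : (permOp σ * B) f g = B (f ∘ σ) g := by
  simp [Matrix.mul_apply, permOp]

theorem mul_permOp_apply {n : ℕ} (σ : Equiv.Perm (Fin n)) (B : Matrix (Cfg n) (Cfg n) ℂ)
    (f g : Cfg n) : (B * permOp σ) f g = B f (g ∘ σ.symm) := by
  have (h : Cfg n) : h ∘ σ = g ↔ h = g ∘ σ.symm := (Equiv.eq_comp_symm σ h g).symm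
  simp [Matrix.mul_apply, permOp, this]

theorem permOp_pow {n : ℕ} (σ : Equiv.Perm (Fin n)) (m : ℕ) : permOp σ ^ m = permOp (σ ^ m) := by
  induction m with
  | zero =>
    ext f g
    simp [permOp, Matrix.one_apply]
  | succ m ih =>
    ext f g
    rw [pow_succ', ih, permOp_mul_apply, pow_succ']
    rfl

theorem permOp_mul_siteOp {n : ℕ} (σ : Equiv.Perm (Fin n)) (X : Matrix (Fin 2) (Fin 2) ℂ)
    (j : Fin n) : permOp σ * siteOp n X j = siteOp n X (σ j) * permOp σ := by
  ext f g
  rw [permOp_mul_apply, mul_permOp_apply]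
  have : (∀ i, i ≠ j → f (σ i) = g i) ↔ ∀ i, i ≠ σ j → f i = g (σ.symm i) := by
    refine ⟨fun h i hi => ?_, fun h i hi => ?_⟩
    · have := h (σ.symm i) (by rwa [Ne, Equiv.symm_apply_eq])
      rwa [Equiv.apply_symm_apply] at this
    · have := h (σ i) (by rwa [Ne, σ.apply_eq_iff_eq])
      rwa [Equiv.symm_apply_apply] at this
  simp [siteOp, this]

/-- The translation of the lattice by one site. -/
noncomputable def siteRotation (n : ℕ) (hn : 0 < n) : Equiv.Perm (Fin n) :=
  Equiv.ofBijective (fun j => site n hn (j.val + 1)) <| Finite.injective_iff_bijective.mp <| by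
    intro i j h
    have h' : (i.val + 1) % n = (j.val + 1) % n := congrArg Fin.val h
    have := Nat.ModEq.add_right_cancel' 1 h'
    exact Fin.ext (by rwa [Nat.ModEq, Nat.mod_eq_of_lt i.2, Nat.mod_eq_of_lt j.2] at this)

theorem rotation_pow_site (n : ℕ) (hn : 0 < n) (m x : ℕ) :
    (siteRotation n hn ^ m) (site n hn x) = site n hn (x + m) := by
  induction m with
  | zero => rfl
  | succ m ih =>
    rw [pow_succ', Equiv.Perm.mul_apply, ih]
    exact Fin.ext (by simp [siteRotation, site, add_assoc])

theorem shiftOp_pow (t : ℕ) (ht : 0 < t) (m : ℕ) :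
    shiftOp t ht ^ m = permOp (siteRotation (2 * t) (by omega) ^ m) := by
  rw [← permOp_pow]
  congr 1
  ext f g
  simp [shiftOp, permOp, siteRotation, funext_iff]

theorem site_add_self (n : ℕ) (hn : 0 < n) (x : ℕ) : site n hn (x + n) = site n hn x :=
  Fin.ext (by simp [site])

theorem site_val (n : ℕ) (hn : 0 < n) (j : Fin n) : site n hn j.val = j :=
  Fin.ext (Nat.mod_eq_of_lt j.2)

theorem site_of_lt (n : ℕ) (hn : 0 < n) (x : ℕ) (hx : x < n) : site n hn x = ⟨x, hx⟩ :=
  Fin.ext (Nat.mod_eq_of_lt hx)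

/-- A sum over a sublattice is invariant under translations by two sites. -/
theorem sum_add_two {M : Type*} [AddCommGroup M] (t : ℕ) (F : ℕ → M)
    (hF : ∀ x, F (x + 2 * t) = F x) (ι : ℕ) :
    ∑ τ : Fin t, F (2 * τ.val + ι + 2) = ∑ τ : Fin t, F (2 * τ.val + ι) := by
  rw [Fin.sum_univ_eq_sum_range (fun τ => F (2 * τ + ι + 2)),
    Fin.sum_univ_eq_sum_range (fun τ => F (2 * τ + ι))]
  have h := (Finset.sum_range_succ' (fun τ => F (2 * τ + ι)) t).symm.trans
    (Finset.sum_range_succ (fun τ => F (2 * τ + ι)) t)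
  have h0 : F (2 * t + ι) = F (2 * 0 + ι) := by rw [add_comm, hF]; simp
  rw [h0, add_left_inj] at h
  rw [← h]
  refine Finset.sum_congr rfl fun τ _ => ?_
  congr 1
  ring

theorem commute_shiftOp_sq_M1 (t : ℕ) (ht : 0 < t) (a : Fin 3) (ι : Fin 2) :
    Commute (shiftOp t ht ^ 2) (M1 t ht a ι) := by
  have hn : 0 < 2 * t := by omega
  rw [shiftOp_pow, Commute, SemiconjBy, M1, Finset.mul_sum, Finset.sum_mul]
  rw [← sum_add_two t (fun x => pauliAt (2 * t) a (site (2 * t) hn x) * _)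
    (fun x => by simp only [site_add_self])]
  refine Finset.sum_congr rfl fun τ _ => ?_
  rw [← siteOp_pauli, permOp_mul_siteOp, rotation_pow_site, siteOp_pauli]

theorem commute_shiftOp_sq_M2 (t : ℕ) (ht : 0 < t) (a b : Fin 3) (ι : Fin 2) :
    Commute (shiftOp t ht ^ 2) (M2 t ht a b ι) := by
  have hn : 0 < 2 * t := by omega
  rw [shiftOp_pow, Commute, SemiconjBy, M2, Finset.mul_sum, Finset.sum_mul]
  rw [← sum_add_two t (fun x => pauliAt (2 * t) a (site (2 * t) hn x) *
      pauliAt (2 * t) b (site (2 * t) hn (x + 1)) * _)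
    (fun x => by simp only [site_add_self, add_right_comm x (2 * t) 1])]
  refine Finset.sum_congr rfl fun τ _ => ?_
  rw [← siteOp_pauli, ← siteOp_pauli, ← mul_assoc, permOp_mul_siteOp, mul_assoc,
    permOp_mul_siteOp, ← mul_assoc, rotation_pow_site, rotation_pow_site, siteOp_pauli,
    siteOp_pauli, add_right_comm _ 1 2]

/-- The commutant of the single and double sublattice magnetizations. -/
def InCommutant (t : ℕ) (ht : 0 < t) (A : Matrix (Cfg (2 * t)) (Cfg (2 * t)) ℂ) : Prop :=
  (∀ (a : Fin 3) (ι : Fin 2), Commute A (M1 t ht a ι)) ∧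
    (∀ (a b : Fin 3) (ι : Fin 2), Commute A (M2 t ht a b ι))

theorem inCommutant_sum_shiftOp_pow (t : ℕ) (ht : 0 < t) (c : Fin t → ℂ) :
    InCommutant t ht (∑ n : Fin t, c n • shiftOp t ht ^ (2 * n.val)) := by
  refine ⟨fun a ι => ?_, fun a b ι => ?_⟩ <;>
    refine Commute.sum_left _ _ _ fun n _ => Commute.smul_left ?_ _ <;> rw [pow_mul]
  · exact (commute_shiftOp_sq_M1 t ht a ι).pow_left _
  · exact (commute_shiftOp_sq_M2 t ht a b ι).pow_left _

namespace InCommutant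

variable {t : ℕ} {ht : 0 < t} {A B : Matrix (Cfg (2 * t)) (Cfg (2 * t)) ℂ}

theorem sub (hA : InCommutant t ht A) (hB : InCommutant t ht B) : InCommutant t ht (A - B) :=
  ⟨fun a ι => (hA.1 a ι).sub_left (hB.1 a ι), fun a b ι => (hA.2 a b ι).sub_left (hB.2 a b ι)⟩

theorem commute_sum_siteOp (hA : InCommutant t ht A) (X : Matrix (Fin 2) (Fin 2) ℂ) (ι : Fin 2) :
    Commute A (∑ τ : Fin t,
      siteOp (2 * t) X (site (2 * t) (by omega) (2 * τ.val + ι.val))) := by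
  induction X using pauli_induction with
  | one => simp only [siteOp_one]; exact Commute.sum_right _ _ _ fun _ _ => Commute.one_right A
  | pauli a => exact hA.1 a ι
  | add X Y hX hY =>
    simp only [siteOp_add, Finset.sum_add_distrib]
    exact hX.add_right hY
  | smul c X hX =>
    simp only [siteOp_smul, ← Finset.smul_sum]
    exact hX.smul_right c

theorem commute_sum_siteOp_succ (hA : InCommutant t ht A) (X : Matrix (Fin 2) (Fin 2) ℂ)
    (ι : Fin 2) :
    Commute A (∑ τ : Fin t,
      siteOp (2 * t) X (site (2 * t) (by omega) (2 * τ.val + ι.val + 1))) := by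
  fin_cases ι
  · exact hA.commute_sum_siteOp X 1
  · have h := hA.commute_sum_siteOp X 0
    rw [← sum_add_two t (fun x => siteOp (2 * t) X (site (2 * t) (by omega) x))
      (fun x => by simp only [site_add_self])] at h
    exact h

theorem commute_sum_siteOp_mul_siteOp (hA : InCommutant t ht A)
    (X Y : Matrix (Fin 2) (Fin 2) ℂ) (ι : Fin 2) :
    Commute A (∑ τ : Fin t,
      siteOp (2 * t) X (site (2 * t) (by omega) (2 * τ.val + ι.val)) *
        siteOp (2 * t) Y (site (2 * t) (by omega) (2 * τ.val + ι.val + 1))) := by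
  induction X using pauli_induction with
  | one => simp only [siteOp_one, one_mul]; exact hA.commute_sum_siteOp_succ Y ι
  | pauli a =>
    induction Y using pauli_induction with
    | one => simp only [siteOp_one, mul_one]; exact hA.commute_sum_siteOp _ ι
    | pauli b => exact hA.2 a b ι
    | add Y Z hY hZ =>
      simp only [siteOp_add, mul_add, Finset.sum_add_distrib]
      exact hY.add_right hZ
    | smul c Y hY =>
      simp only [siteOp_smul, mul_smul_comm, ← Finset.smul_sum]
      exact hY.smul_right c
  | add X Z hX hZ =>
    simp only [siteOp_add, add_mul, Finset.sum_add_distrib]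
    exact hX.add_right hZ
  | smul c X hX =>
    simp only [siteOp_smul, smul_mul_assoc, ← Finset.smul_sum]
    exact hX.smul_right c

/-- The number of excitations on each sublattice is conserved. -/
theorem card_eq_of_apply_ne_zero (hA : InCommutant t ht A) {f g : Cfg (2 * t)} (h : A f g ≠ 0)
    (ι : Fin 2) :
    (Finset.univ.filter fun τ : Fin t =>
      f (site (2 * t) (by omega) (2 * τ.val + ι.val)) = 1).card =
    (Finset.univ.filter fun τ : Fin t =>
      g (site (2 * t) (by omega) (2 * τ.val + ι.val)) = 1).card := by
  have hc := congrFun₂ (hA.commute_sum_siteOp (Matrix.single 1 1 1) ι).eq f g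
  simp only [siteOp_single_self, Finset.mul_sum, Finset.sum_mul, Matrix.sum_apply,
    Matrix.mul_diagonal, Matrix.diagonal_mul] at hc
  rw [← Finset.mul_sum, ← Finset.sum_mul, mul_comm, mul_left_inj' h, Finset.sum_boole,
    Finset.sum_boole] at hc
  exact_mod_cast hc.symm

/-- If the column of `A` at `g` vanishes and all but one of the terms of a pair operator applied
to `g` lie in the kernel of `A`, then so does the remaining one. -/
theorem apply_eq_zero_of_pair (hA : InCommutant t ht A) {g : Cfg (2 * t)} (hg : ∀ f, A f g = 0)
    (ι : Fin 2) (a b : Fin 2) (τ₀ : Fin t)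
    (h₁ : g (site (2 * t) (by omega) (2 * τ₀.val + ι.val)) = 1)
    (h₀ : g (site (2 * t) (by omega) (2 * τ₀.val + ι.val + 1)) = 0)
    (h : ∀ τ : Fin t, τ ≠ τ₀ → g (site (2 * t) (by omega) (2 * τ.val + ι.val)) = 1 → ∀ f,
      A f (Function.update
        (Function.update g (site (2 * t) (by omega) (2 * τ.val + ι.val + 1)) b)
        (site (2 * t) (by omega) (2 * τ.val + ι.val)) a) = 0) (f : Cfg (2 * t)) :
    A f (Function.update
      (Function.update g (site (2 * t) (by omega) (2 * τ₀.val + ι.val + 1)) b)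
      (site (2 * t) (by omega) (2 * τ₀.val + ι.val)) a) = 0 := by
  have hne (τ : Fin t) : site (2 * t) (by omega) (2 * τ.val + ι.val) ≠
      site (2 * t) (by omega) (2 * τ.val + ι.val + 1) := by
    intro he
    have he := congrArg (fun x : Fin (2 * t) => x.val % 2) he
    simp only [site, Nat.mod_mul_right_mod] at he
    omega
  have hc := congrFun₂ (hA.commute_sum_siteOp_mul_siteOp (Matrix.single a 1 1)
    (Matrix.single b 0 1) ι).eq f g
  have hr : ∀ B : Matrix (Cfg (2 * t)) (Cfg (2 * t)) ℂ, (B * A) f g = 0 := fun B => by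
    simp [Matrix.mul_apply, hg]
  rw [hr, Finset.mul_sum, Matrix.sum_apply, Finset.sum_eq_single τ₀] at hc
  · simpa [← mul_assoc, mul_siteOp_single_apply, hne, h₁, h₀] using hc
  · intro τ _ hτ
    rw [← mul_assoc, mul_siteOp_single_apply, mul_siteOp_single_apply,
      Function.update_of_ne (hne τ)]
    split_ifs with h2 h3
    · exact h τ hτ h3 f
    · rfl
    · rfl
  · simp

/-- An element of the commutant annihilating the configuration with a single excitation, at the
origin, vanishes. -/
theorem eq_zero (hA : InCommutant t ht A)
    (h : ∀ f, A f (Pi.single (site (2 * t) (by omega) 0) 1) = 0) : A = 0 := by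
  have hn : 0 < 2 * t := by omega
  have key : ∀ k, 1 ≤ k → k ≤ 2 * t → ∀ g : Cfg (2 * t), (∀ i, k ≤ i.val → g i = 0) →
      ∀ f, A f g = 0 := by
    intro k hk
    induction k, hk using Nat.le_induction with
    | base =>
      intro _ g hg
      have hz : ∀ i, i ≠ site (2 * t) hn 0 → g i = 0 := fun i hi => hg i <| by
        by_contra hlt
        exact hi (Fin.ext (by simp [site]; omega))
      by_cases h1 : g (site (2 * t) hn 0) = 1
      · have : g = Pi.single (site (2 * t) hn 0) 1 := by
          funext i
          by_cases hi : i = site (2 * t) hn 0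
          · rw [hi, h1, Pi.single_eq_same]
          · rw [Pi.single_eq_of_ne hi, hz i hi]
        rw [this]
        exact h
      · have hp := hA.apply_eq_zero_of_pair h 0 0 0 ⟨0, ht⟩ (by simp)
          (Pi.single_eq_of_ne (by simp [site, Fin.ext_iff]) _)
          (fun τ hτ h1 => by
            rw [Pi.single_eq_of_ne] at h1
            · simp at h1
            · rw [site_of_lt _ _ _ (by simp), site_of_lt _ _ _ hn]
              intro he
              exact hτ (Fin.ext (by simpa using he)))
        convert hp using 3 with f
        funext i
        simp only [Function.update_apply, Pi.single_apply]
        by_cases hi : i = site (2 * t) hn 0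
        · simp [hi]; omega
        · simp [hi, hz i hi]
    | succ k hk ih =>
      intro hkt g hg
      have ih := ih (by omega)
      set p : Fin (2 * t) := ⟨k - 1, by omega⟩ with hp
      set q : Fin (2 * t) := ⟨k, by omega⟩ with hq
      have hpq : p ≠ q := by simp [hp, hq]; omega
      set g' := Function.update (Function.update g q 0) p 1 with hg'
      have hsupp : ∀ i : Fin (2 * t), k ≤ i.val → g' i = 0 := by
        intro i hi
        have hip : i ≠ p := by simp [hp, Fin.ext_iff]; omega
        rw [hg', Function.update_of_ne hip, Function.update_apply]
        split_ifs with hiq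
        · rfl
        · exact hg i (by have : i.val ≠ k := fun he => hiq (Fin.ext he)
                         omega)
      have hmod : (k - 1) % 2 < 2 := Nat.mod_lt _ (by omega)
      have hs : 2 * ((k - 1) / 2) + (k - 1) % 2 = k - 1 := Nat.div_add_mod _ _
      have hsp : site (2 * t) hn (2 * ((k - 1) / 2) + (k - 1) % 2) = p := by
        rw [hs, site_of_lt]
      have hsq : site (2 * t) hn (2 * ((k - 1) / 2) + (k - 1) % 2 + 1) = q := by
        rw [hs, Nat.sub_add_cancel hk, site_of_lt]
      have hstep := hA.apply_eq_zero_of_pair (ih g' hsupp) ⟨(k - 1) % 2, hmod⟩ (g p) (g q)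
        ⟨(k - 1) / 2, by omega⟩ (by simp only [hsp]; simp [hg'])
        (by simp only [hsq]; simp [hg', hpq.symm])
        (fun τ hτ h1 => by
          have hlt : 2 * τ.val + (k - 1) % 2 < 2 * t := by omega
          have hlt' : 2 * τ.val + (k - 1) % 2 < k := by
            by_contra hge
            rw [hsupp _ (by simp only [site_of_lt _ _ _ hlt]; omega)] at h1
            simp at h1
          have hτ' : τ.val ≠ (k - 1) / 2 := fun he => hτ (Fin.ext he)
          refine ih _ fun i hi => ?_
          rw [site_of_lt _ _ _ hlt, site_of_lt _ _ _ (show _ + 1 < _ by simp only; omega),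
            Function.update_of_ne, Function.update_of_ne, hsupp i hi] <;>
            · simp only [Ne, Fin.ext_iff]
              omega)
      simp only [hsp, hsq] at hstep
      convert hstep using 3
      simp only [hg']
      funext i
      simp only [Function.update_apply]
      split_ifs with h1 h2
      · rw [h1]
      · rw [h2]
      · rfl
  ext f g
  exact key (2 * t) (by omega) le_rfl g (fun i hi => absurd i.2 (by omega)) f

end InCommutant

theorem shiftOp_pow_apply_single (t : ℕ) (ht : 0 < t) (m : ℕ) (f : Cfg (2 * t)) :
    (shiftOp t ht ^ m) f (Pi.single (site (2 * t) (by omega) 0) 1) =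
      if f = Pi.single (site (2 * t) (by omega) m) 1 then 1 else 0 := by
  rw [shiftOp_pow, permOp]
  congr 1
  rw [← Equiv.eq_comp_symm]
  congr! 2
  funext i
  simp only [Function.comp, Pi.single_apply]
  simp only [Equiv.symm_apply_eq, rotation_pow_site, zero_add]

theorem single_site_two_mul_inj {t : ℕ} (ht : 0 < t) (m n : Fin t) :
    (Pi.single (site (2 * t) (by omega) (2 * m.val)) 1 : Cfg (2 * t)) =
      Pi.single (site (2 * t) (by omega) (2 * n.val)) 1 ↔ m = n := by
  refine ⟨fun h => ?_, fun h => by rw [h]⟩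
  have h := congrFun h (site (2 * t) (by omega) (2 * m.val))
  rw [Pi.single_eq_same, Pi.single_apply] at h
  split_ifs at h with he
  · rw [site_of_lt _ _ _ (by omega), site_of_lt _ _ _ (by omega), Fin.mk.injEq] at he
    exact Fin.ext (by omega)
  · simp at h

theorem sum_shiftOp_pow_apply_single (t : ℕ) (ht : 0 < t) (c : Fin t → ℂ) (m : Fin t) :
    (∑ n : Fin t, c n • shiftOp t ht ^ (2 * n.val))
      (Pi.single (site (2 * t) (by omega) (2 * m.val)) 1)
      (Pi.single (site (2 * t) (by omega) 0) 1) = c m := by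
  simp [Matrix.sum_apply, shiftOp_pow_apply_single, single_site_two_mul_inj ht]

theorem InCommutant.exists_eq_single {t : ℕ} {ht : 0 < t}
    {A : Matrix (Cfg (2 * t)) (Cfg (2 * t)) ℂ} (hA : InCommutant t ht A) {f : Cfg (2 * t)}
    (h : A f (Pi.single (site (2 * t) (by omega) 0) 1) ≠ 0) :
    ∃ m : Fin t, f = Pi.single (site (2 * t) (by omega) (2 * m.val)) 1 := by
  have hn : 0 < 2 * t := by omega
  have h0 := hA.card_eq_of_apply_ne_zero h 0
  have h1 := hA.card_eq_of_apply_ne_zero h 1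
  have hs (τ : Fin t) (ι : Fin 2) : (Pi.single (site (2 * t) hn 0) 1 : Cfg (2 * t))
      (site (2 * t) hn (2 * τ.val + ι.val)) = 1 ↔ τ = ⟨0, ht⟩ ∧ ι = 0 := by
    rw [Pi.single_apply, site_of_lt _ _ _ (show _ < _ by omega), site_of_lt _ _ _ hn]
    split_ifs with he <;> simp only [Fin.mk.injEq] at he
    · exact iff_of_true rfl ⟨Fin.ext (show τ.val = 0 by omega), by omega⟩
    · refine iff_of_false zero_ne_one ?_
      rintro ⟨rfl, rfl⟩
      exact he rfl
  simp only [hs] at h0 h1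
  simp only [and_true, Finset.filter_eq', Finset.mem_univ, if_true, Finset.card_singleton,
    Finset.card_eq_one] at h0
  simp only [one_ne_zero, and_false, Finset.filter_false, Finset.card_empty,
    Finset.card_eq_zero] at h1
  obtain ⟨m, hm⟩ := h0
  refine ⟨m, funext fun i => ?_⟩
  have e0 (τ : Fin t) : f (site (2 * t) hn (2 * τ.val)) = 1 ↔ τ = m := by
    simpa using Finset.ext_iff.mp hm τ
  have e1 (τ : Fin t) : f (site (2 * t) hn (2 * τ.val + 1)) ≠ 1 := by
    simpa using Finset.ext_iff.mp h1 τ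
  have hi : i.val / 2 < t := by omega
  rw [Pi.single_apply, ← site_val _ hn i]
  rcases Nat.mod_two_eq_zero_or_one i.val with hpar | hpar
  · have hv : 2 * (⟨i.val / 2, hi⟩ : Fin t).val = i.val := by simp only; omega
    have he := e0 ⟨i.val / 2, hi⟩
    rw [hv] at he
    split_ifs with hc
    · rw [hc]
      exact (e0 m).mpr rfl
    · have : f (site (2 * t) hn i.val) ≠ 1 := fun h1 => hc <| by
        rw [← he.mp h1, hv]
      omega
  · have hv : 2 * (⟨i.val / 2, hi⟩ : Fin t).val + 1 = i.val := by simp only; omega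
    have he := e1 ⟨i.val / 2, hi⟩
    rw [hv] at he
    rw [if_neg]
    · omega
    · rw [site_val, site_of_lt _ _ _ (by omega), Fin.ext_iff]
      simp only
      omega

theorem commutant_of_sublattice_magnetizations (t : ℕ) (ht : 0 < t) :
    (∀ A : Matrix (Cfg (2 * t)) (Cfg (2 * t)) ℂ,
      ((∀ (a : Fin 3) (ι : Fin 2), Commute A (M1 t ht a ι)) ∧
        (∀ (a b : Fin 3) (ι : Fin 2), Commute A (M2 t ht a b ι))) ↔
      ∃ c : Fin t → ℂ, A = ∑ n : Fin t, c n • shiftOp t ht ^ (2 * n.val)) ∧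
    LinearIndependent ℂ (fun n : Fin t => shiftOp t ht ^ (2 * n.val)) := by
  refine ⟨fun A => ⟨fun hA => ?_, ?_⟩, ?_⟩
  · have hA : InCommutant t ht A := hA
    refine ⟨fun m => A (Pi.single (site (2 * t) (by omega) (2 * m.val)) 1)
      (Pi.single (site (2 * t) (by omega) 0) 1), ?_⟩
    have hS := hA.sub (inCommutant_sum_shiftOp_pow t ht fun m =>
      A (Pi.single (site (2 * t) (by omega) (2 * m.val)) 1)
        (Pi.single (site (2 * t) (by omega) 0) 1))
    refine sub_eq_zero.mp (hS.eq_zero fun f => ?_)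
    by_contra hne
    obtain ⟨m, rfl⟩ := hS.exists_eq_single hne
    rw [Matrix.sub_apply, sum_shiftOp_pow_apply_single, sub_self] at hne
    exact hne rfl
  · rintro ⟨c, rfl⟩
    exact inCommutant_sum_shiftOp_pow t ht c
  · rw [Fintype.linearIndependent_iff]
    intro c hc m
    rw [← sum_shiftOp_pow_apply_single t ht c m, hc, Matrix.zero_apply]
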